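/- For k, n, k', n' ∈ ℕ, there exists w ∈ W with wλ_{k,n} = λ_{k',n'} if and only if k = k' and n = n'. In particular the weights λ_{k,n} are pairwise distinct and lie in pairwise distinct W-orbits. -/

import Mathlib

noncomputable section

/-- The weight space of the exceptional Lie superalgebra `G(3)`. -/
abbrev V : Type := ℚ × ℚ × ℚ

def δ : V := (1, 0, 0)
def ε₁ : V := (0, 1, 0)
def ε₂ : V := (0, 0, 1)
def ε₃ : V := -ε₁ - ε₂

/-- The symmetric bilinear form on `V` determined by `B(δ,δ) = -2`, `B(δ,εᵢ) = 0`,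
`B(εᵢ,εᵢ) = 2` and `B(εᵢ,εⱼ) = -1` for `i ≠ j` (with `ε₃ = -ε₁-ε₂`). -/
def B (u v : V) : ℚ :=
  -2 * u.1 * v.1 + 2 * u.2.1 * v.2.1 + 2 * u.2.2 * v.2.2 - u.2.1 * v.2.2 - u.2.2 * v.2.1

/-- `s₀ : δ ↦ -δ, ε₁ ↦ ε₁, ε₂ ↦ ε₂`. -/
def s₀ : V ≃ₗ[ℚ] V where
  toFun v := (-v.1, v.2.1, v.2.2)
  invFun v := (-v.1, v.2.1, v.2.2)
  map_add' a b := by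
    simp only [Prod.ext_iff, Prod.fst_add, Prod.snd_add]
    refine ⟨by ring, by trivial, by trivial⟩
  map_smul' c a := by
    simp only [Prod.ext_iff, Prod.smul_fst, Prod.smul_snd, smul_eq_mul, RingHom.id_apply]
    refine ⟨by ring, by trivial, by trivial⟩
  left_inv v := by simp
  right_inv v := by simp

/-- `s₁ : δ ↦ δ, ε₁ ↦ ε₂, ε₂ ↦ ε₁`. -/
def s₁ : V ≃ₗ[ℚ] V where
  toFun v := (v.1, v.2.2, v.2.1)
  invFun v := (v.1, v.2.2, v.2.1)
  map_add' a b := by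
    simp only [Prod.ext_iff, Prod.fst_add, Prod.snd_add]
    refine ⟨by trivial, by trivial, by trivial⟩
  map_smul' c a := by
    simp only [Prod.ext_iff, Prod.smul_fst, Prod.smul_snd, smul_eq_mul, RingHom.id_apply]
    refine ⟨by trivial, by trivial, by trivial⟩
  left_inv v := by simp
  right_inv v := by simp

/-- `s₂ : δ ↦ δ, ε₁ ↦ -ε₁, ε₂ ↦ ε₁ + ε₂`. -/
def s₂ : V ≃ₗ[ℚ] V where
  toFun v := (v.1, v.2.2 - v.2.1, v.2.2)
  invFun v := (v.1, v.2.2 - v.2.1, v.2.2)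
  map_add' a b := by
    simp only [Prod.ext_iff, Prod.fst_add, Prod.snd_add]
    refine ⟨by trivial, by ring, by trivial⟩
  map_smul' c a := by
    simp only [Prod.ext_iff, Prod.smul_fst, Prod.smul_snd, smul_eq_mul, RingHom.id_apply]
    refine ⟨by trivial, by ring, by trivial⟩
  left_inv v := by
    obtain ⟨a, b, c⟩ := v
    simp only [Prod.mk.injEq]
    norm_num
  right_inv v := by
    obtain ⟨a, b, c⟩ := v
    simp only [Prod.mk.injEq]
    norm_num

/-- The integral Weyl group `W = ⟨s₀, s₁, s₂⟩` of `G(3)`. -/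
def W : Subgroup (V ≃ₗ[ℚ] V) := Subgroup.closure {s₀, s₁, s₂}

/-- The set of positive even roots of `G(3)`. -/
def Φ₀ : Set V := {(2:ℚ) • δ, ε₁, ε₂, -ε₃, ε₂ - ε₁, ε₁ - ε₃, ε₂ - ε₃}

/-- The positive even roots, as a finite set. -/
def Φ₀F : Finset V := {(2:ℚ) • δ, ε₁, ε₂, -ε₃, ε₂ - ε₁, ε₁ - ε₃, ε₂ - ε₃}

/-- The positive odd roots, as a finite set. -/
def Φ₁F : Finset V := {δ, δ + ε₁, δ - ε₁, δ + ε₂, δ - ε₂, δ + ε₃, δ - ε₃}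

/-- The isotropic positive odd roots of `G(3)`. -/
def oddIso : Set V := {δ + ε₁, δ - ε₁, δ + ε₂, δ - ε₂, δ + ε₃, δ - ε₃}

/-- The `ρ`-shifted integral weight lattice `X + ρ`. -/
def Xρ : Set V :=
  {v : V | ∃ (m c₁ c₂ : ℤ), v = ((m : ℚ) + 1/2) • δ + (c₁ : ℚ) • ε₁ + (c₂ : ℚ) • ε₂}

/-- The symbol `[d | x, y, z]` of a weight `λ`. -/
def symb (v : V) : ℚ × ℚ × ℚ × ℚ := (-(B v δ)/2, B v ε₁/2, B v ε₂/2, B v ε₃/2)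

/-- The set of symbols `𝔖ymb`. -/
def Symb : Set (ℚ × ℚ × ℚ × ℚ) :=
  {s | (∃ m : ℤ, s.1 = (m : ℚ) + 1/2) ∧ (∃ m : ℤ, 2 * s.2.1 = (m : ℚ)) ∧
       (∃ m : ℤ, 2 * s.2.2.1 = (m : ℚ)) ∧ s.2.2.2 = -s.2.1 - s.2.2.1 ∧
       (∃ m : ℤ, 2 * (s.2.2.1 - s.2.1) / 3 = (m : ℚ))}

/-- The fundamental weight `ω₁` of `G₂`. -/
def ω₁ : V := ε₁ + (2:ℚ) • ε₂

/-- The fundamental weight `ω₂` of `G₂`. -/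
def ω₂ : V := ε₁ + ε₂

/-- The inverse of the symbol map. -/
def Ψinv (s : ℚ × ℚ × ℚ × ℚ) : V :=
  s.1 • δ + (2 * (s.2.2.1 - s.2.1) / 3) • ω₁ + (2 * s.2.1) • ω₂

/-- The atypical anti-dominant weights `λ_{k,n}`. -/
def lam (k n : ℕ) : V :=
  if n < k then
    (-((2*(n:ℚ)+1)/2)) • δ - ((n:ℚ)+(k:ℚ)+1) • ε₁ - (2*(k:ℚ)+1) • ε₂
  else if n = k then
    (-((2*(k:ℚ)+1)/2)) • δ - (2*(k:ℚ)+1) • ε₁ - (2*(k:ℚ)+1) • ε₂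
  else if n ≤ 3*k then
    (-((2*(n:ℚ)+1)/2)) • δ - (2*(k:ℚ)+1) • ε₁ - ((n:ℚ)+(k:ℚ)+1) • ε₂
  else if n = 3*k+1 then
    (-((6*(k:ℚ)+3)/2)) • δ - (2*(k:ℚ)+1) • ε₁ - (4*(k:ℚ)+2) • ε₂
  else
    (-((2*(n:ℚ)+1)/2)) • δ - ((n:ℚ)-(k:ℚ)) • ε₁ - ((n:ℚ)+(k:ℚ)+1) • ε₂

/-- The atypical anti-dominant symbols `f_{k,n}`. -/
def fsym (k n : ℕ) : ℚ × ℚ × ℚ × ℚ :=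
  if n < k then
    (-(2*(n:ℚ)+1)/2, -(2*(n:ℚ)+1)/2, ((n:ℚ)-3*(k:ℚ)-1)/2, (3*(k:ℚ)+(n:ℚ)+2)/2)
  else if n = k then
    (-(2*(k:ℚ)+1)/2, -(2*(k:ℚ)+1)/2, -(2*(k:ℚ)+1)/2, 2*(k:ℚ)+1)
  else if n ≤ 3*k then
    (-(2*(n:ℚ)+1)/2, ((n:ℚ)-3*(k:ℚ)-1)/2, -(2*(n:ℚ)+1)/2, (3*(k:ℚ)+(n:ℚ)+2)/2)
  else if n = 3*k+1 then
    (-(3*(2*(k:ℚ)+1))/2, 0, -(3*(2*(k:ℚ)+1))/2, 3*(2*(k:ℚ)+1)/2)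
  else
    (-(2*(n:ℚ)+1)/2, -((n:ℚ)-3*(k:ℚ)-1)/2, -(3*(k:ℚ)+(n:ℚ)+2)/2, (2*(n:ℚ)+1)/2)

/-- The Weyl vector `ρ` of `G(3)`. -/
def ρ : V := (-(5/2) : ℚ) • δ + (2:ℚ) • ε₁ + (3:ℚ) • ε₂

/-- The squared `δ`-coordinate is `W`-invariant. -/
lemma fst_sq_apply_of_mem_W {w : V ≃ₗ[ℚ] V} (hw : w ∈ W) (v : V) :
    (w v).1 ^ 2 = v.1 ^ 2 := by
  induction hw using Subgroup.closure_induction generalizing v with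
  | mem g hg => rcases hg with rfl | rfl | rfl <;> simp [s₀, s₁, s₂]
  | one => rfl
  | mul g h _ _ hg hh => rw [LinearEquiv.mul_apply, hg, hh]
  | inv g _ hg => rw [← hg, ← LinearEquiv.mul_apply, mul_inv_cancel, LinearEquiv.coe_one, id]

/-- The bilinear form is `W`-invariant on the diagonal. -/
lemma B_self_apply_of_mem_W {w : V ≃ₗ[ℚ] V} (hw : w ∈ W) (v : V) :
    B (w v) (w v) = B v v := by
  induction hw using Subgroup.closure_induction generalizing v with
  | mem g hg => rcases hg with rfl | rfl | rfl <;> simp [B, s₀, s₁, s₂] <;> ring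
  | one => rfl
  | mul g h _ _ hg hh => rw [LinearEquiv.mul_apply, hg, hh]
  | inv g _ hg => rw [← hg, ← LinearEquiv.mul_apply, mul_inv_cancel, LinearEquiv.coe_one, id]

lemma lam_fst (k n : ℕ) : (lam k n).1 = -((2 * (n : ℚ) + 1) / 2) := by
  unfold lam
  split_ifs <;> simp [δ, ε₁, ε₂] <;> subst_vars <;> push_cast <;> ring

lemma B_lam_self (k n : ℕ) : B (lam k n) (lam k n) = 3 / 2 * (2 * (k : ℚ) + 1) ^ 2 := by
  unfold lam B
  split_ifs <;> simp [δ, ε₁, ε₂] <;> subst_vars <;> ring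

/-- For `k, n, k', n' ∈ ℕ`, there exists `w ∈ W` with `wλ_{k,n} = λ_{k',n'}` if and only if
`k = k'` and `n = n'`; in particular the weights `λ_{k,n}` are pairwise distinct and lie
in pairwise distinct `W`-orbits. -/
theorem lam_orbits_distinct (k n k' n' : ℕ) :
    (∃ w : V ≃ₗ[ℚ] V, w ∈ W ∧ w (lam k n) = lam k' n') ↔ (k = k' ∧ n = n') := by
  constructor
  · rintro ⟨w, hw, h⟩
    have hB := B_self_apply_of_mem_W hw (lam k n)
    have hδ := fst_sq_apply_of_mem_W hw (lam k n)
    rw [h, B_lam_self, B_lam_self] at hB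
    rw [h, lam_fst, lam_fst, neg_sq, neg_sq, sq_eq_sq₀ (by positivity) (by positivity)] at hδ
    have hk := (sq_eq_sq₀ (by positivity) (by positivity)).mp
      (mul_left_cancel₀ (by norm_num) hB)
    constructor
    · have : (k : ℚ) = k' := by linarith
      exact_mod_cast this
    · have : (n : ℚ) = n' := by linarith
      exact_mod_cast this
  · rintro ⟨rfl, rfl⟩
    exact ⟨1, W.one_mem, rfl⟩
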